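/- arXiv:1605.08687 — 2 statements merged into one kernel-verified Lean document; each statement's English description precedes it below -/
import Mathlib

section
/- Let m ≥ 2, n ≥ 1, let A be an order m dimension n tensor over ℂ, and let k ≥ 1. Then R(A^k) ≤ (R(A))^{μ_k}, where μ_k = ∑_{j=0}^{k-1} (m-1)^j. -/
open Finset

/-- The `i`-th row sum of a tensor of dimension `n` whose "tail" indices
are indexed by `ι` (a tensor of order `Fintype.card ι + 1`). -/
def rS {n : ℕ} {ι : Type} [Fintype ι] [DecidableEq ι] {𝕜 : Type} [RCLike 𝕜]
    (A : Fin n → (ι → Fin n) → 𝕜) (i : Fin n) : ℝ :=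
  ∑ t : ι → Fin n, ‖A i t‖

/-- The general (Shao) product of tensors. -/
def gP {n : ℕ} {ι κ : Type} [Fintype ι] [DecidableEq ι] [Fintype κ] [DecidableEq κ]
    {𝕜 : Type} [RCLike 𝕜]
    (A : Fin n → (ι → Fin n) → 𝕜) (B : Fin n → (κ → Fin n) → 𝕜) :
    Fin n → (ι × κ → Fin n) → 𝕜 :=
  fun i α => ∑ t : ι → Fin n, A i t * ∏ j : ι, B (t j) (fun l => α (j, l))

/-- Maximum of a real-valued function on `Fin n`, `n ≥ 1`. -/
def maxF {n : ℕ} (hn : 1 ≤ n) (f : Fin n → ℝ) : ℝ :=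
  Finset.univ.sup' ⟨⟨0, hn⟩, Finset.mem_univ _⟩ f

/-- Minimum of a real-valued function on `Fin n`, `n ≥ 1`. -/
def minF {n : ℕ} (hn : 1 ≤ n) (f : Fin n → ℝ) : ℝ :=
  Finset.univ.inf' ⟨⟨0, hn⟩, Finset.mem_univ _⟩ f

/-- `lam` is an eigenvalue of the tensor `T`. -/
def IsEig {n : ℕ} {ι : Type} [Fintype ι] [DecidableEq ι]
    (T : Fin n → (ι → Fin n) → ℂ) (lam : ℂ) : Prop :=
  ∃ x : Fin n → ℂ, x ≠ 0 ∧ ∀ i : Fin n,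
    (∑ t : ι → Fin n, T i t * ∏ j : ι, x (t j)) = lam * x i ^ (Fintype.card ι)

/-- Tail-index type of the `(j+1)`-st power of a tensor with tail-index type `ι`. -/
def PowIdx (ι : Type) : ℕ → Type
  | 0 => ι
  | j + 1 => ι × PowIdx ι j

instance PowIdx.instFintype (ι : Type) [Fintype ι] : (j : ℕ) → Fintype (PowIdx ι j)
  | 0 => inferInstanceAs (Fintype ι)
  | j + 1 => letI := PowIdx.instFintype ι j; inferInstanceAs (Fintype (ι × PowIdx ι j))

instance PowIdx.instDecEq (ι : Type) [DecidableEq ι] : (j : ℕ) → DecidableEq (PowIdx ι j)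
  | 0 => inferInstanceAs (DecidableEq ι)
  | j + 1 => letI := PowIdx.instDecEq ι j; inferInstanceAs (DecidableEq (ι × PowIdx ι j))

/-- `tpow A j` is the `(j+1)`-st power `A^(j+1)` of `A` under the general product:
`tpow A 0 = A` and `tpow A (j+1) = A * (tpow A j)`. -/
def tpow {n : ℕ} {ι : Type} [Fintype ι] [DecidableEq ι] {𝕜 : Type} [RCLike 𝕜]
    (A : Fin n → (ι → Fin n) → 𝕜) : (j : ℕ) → Fin n → (PowIdx ι j → Fin n) → 𝕜
  | 0 => A
  | j + 1 => gP A (tpow A j)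

/-- The arc relation of the digraph associated with a tensor. -/
def Arc {n : ℕ} {ι : Type} [Fintype ι] [DecidableEq ι]
    (T : Fin n → (ι → Fin n) → ℂ) (i j : Fin n) : Prop :=
  ∃ t : ι → Fin n, T i t ≠ 0 ∧ (∃ l, t l = j) ∧ t ≠ fun _ => i

/-- `γ` is a circuit of the digraph associated with `T`: a nonempty list of
pairwise distinct vertices with arcs between consecutive vertices and an arc
from the last vertex back to the first. -/
def IsCircuit {n : ℕ} {ι : Type} [Fintype ι] [DecidableEq ι]
    (T : Fin n → (ι → Fin n) → ℂ) (γ : List (Fin n)) : Prop :=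
  ∃ h : γ ≠ [], γ.Nodup ∧ List.Chain' (Arc T) γ ∧ Arc T (γ.getLast h) (γ.head h)

/-- The row sums of a general product are bounded by those of the factors. -/
theorem rS_gP_le {n : ℕ} {ι κ : Type} [Fintype ι] [DecidableEq ι] [Fintype κ] [DecidableEq κ]
    {𝕜 : Type} [RCLike 𝕜] (A : Fin n → (ι → Fin n) → 𝕜) (B : Fin n → (κ → Fin n) → 𝕜)
    {b : ℝ} (hb : ∀ i, rS B i ≤ b) (i : Fin n) :
    rS (gP A B) i ≤ rS A i * b ^ Fintype.card ι := by
  have sum_prod (t : ι → Fin n) :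
      ∑ α : ι × κ → Fin n, ∏ j : ι, ‖B (t j) (fun l => α (j, l))‖ = ∏ j : ι, rS B (t j) := by
    simp only [rS]
    rw [Fintype.prod_sum]
    exact Fintype.sum_equiv (Equiv.curry ι κ (Fin n)) _ _ fun _ => rfl
  calc rS (gP A B) i
      ≤ ∑ α : ι × κ → Fin n, ∑ t : ι → Fin n,
          ‖A i t‖ * ∏ j : ι, ‖B (t j) (fun l => α (j, l))‖ := by
        refine Finset.sum_le_sum fun α _ => (norm_sum_le _ _).trans_eq ?_
        simp only [norm_mul, norm_prod]
    _ = ∑ t : ι → Fin n, ‖A i t‖ * ∏ j : ι, rS B (t j) := by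
        rw [Finset.sum_comm]
        simp only [← Finset.mul_sum, sum_prod]
    _ ≤ ∑ t : ι → Fin n, ‖A i t‖ * b ^ Fintype.card ι := by
        refine Finset.sum_le_sum fun t _ => mul_le_mul_of_nonneg_left ?_ (norm_nonneg _)
        refine (Finset.prod_le_prod (fun j _ => Finset.sum_nonneg fun _ _ => norm_nonneg _)
          fun j _ => hb (t j)).trans_eq ?_
        rw [Finset.prod_const, Finset.card_univ]
    _ = rS A i * b ^ Fintype.card ι := by rw [rS, Finset.sum_mul]

/-- A uniform bound on the row sums of `A` bounds the row sums of its powers. -/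
theorem rS_tpow_le {n : ℕ} {ι : Type} [Fintype ι] [DecidableEq ι] {𝕜 : Type} [RCLike 𝕜]
    (A : Fin n → (ι → Fin n) → 𝕜) {a : ℝ} (ha : ∀ i, rS A i ≤ a) (j : ℕ) (i : Fin n) :
    rS (tpow A j) i ≤ a ^ ∑ l ∈ Finset.range (j + 1), Fintype.card ι ^ l := by
  have ha0 : 0 ≤ a := (Finset.sum_nonneg fun _ _ => norm_nonneg _).trans (ha i)
  induction j generalizing i with
  | zero =>
    have h : rS (tpow A 0) i ≤ a := ha i
    simpa using h
  | succ j ih =>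
    refine (rS_gP_le A (tpow A j) ih i).trans ?_
    rw [geom_sum_succ (n := j + 1), pow_succ' a, mul_comm (Fintype.card ι), pow_mul]
    exact mul_le_mul_of_nonneg_right (ha i) (by positivity)

/-- For a tensor `A` of order `m` over ℂ and `k ≥ 1`,
`R(A^k) ≤ (R(A))^{μ_k}` where `μ_k = ∑_{j=0}^{k-1} (m-1)^j`.
(Here `tpow A (k-1)` is the `k`-th power `A^k` under the general product.) -/
theorem stmt2 (m n k : ℕ) (hm : 2 ≤ m) (hn : 1 ≤ n) (hk : 1 ≤ k)
    (A : Fin n → (Fin (m - 1) → Fin n) → ℂ) :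
    maxF hn (rS (tpow A (k - 1))) ≤
      (maxF hn (rS A)) ^ (∑ j ∈ Finset.range k, (m - 1) ^ j) := by
  obtain ⟨j, rfl⟩ := Nat.exists_eq_add_of_le' hk
  refine Finset.sup'_le _ _ fun i _ => ?_
  simpa using rS_tpow_le A (fun i => Finset.le_sup' (rS A) (Finset.mem_univ i)) j i
end

section
/- Let m ≥ 2, n ≥ 1, let k ≥ 1 be a fixed positive integer, and let A be an order m dimension n nonnegative weakly irreducible tensor. Let λ₀ ∈ ℝ be an eigenvalue of A admitting a strictly positive eigenvector x ∈ ℝⁿ (which exists by the Perron–Frobenius theorem for nonnegative weakly irreducible tensors). Then λ₀ equals the supremum, over all order k dimension n nonnegative tensors B with r_i(B) ≠ 0 for all i, of min_{i∈{1,…,n}} r_i(AB)/(r_i(B))^{m-1}, and λ₀ also equals the infimum over the same family of B of max_{i∈{1,…,n}} r_i(AB)/(r_i(B))^{m-1}. -/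
open Finset

/-- Row sums of the product of nonnegative tensors depend on the right factor
only through its row sums. -/
lemma rS_gP_of_nonneg {n : ℕ} {ι κ : Type} [Fintype ι] [DecidableEq ι] [Fintype κ] [DecidableEq κ]
    {A : Fin n → (ι → Fin n) → ℝ} {B : Fin n → (κ → Fin n) → ℝ}
    (hA : ∀ i t, 0 ≤ A i t) (hB : ∀ i t, 0 ≤ B i t) (i : Fin n) :
    rS (gP A B) i = ∑ t : ι → Fin n, A i t * ∏ j, rS B (t j) := by
  have hpos (α : ι × κ → Fin n) : 0 ≤ gP A B i α :=
    Finset.sum_nonneg fun t _ => mul_nonneg (hA i t) (Finset.prod_nonneg fun j _ => hB _ _)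
  simp only [rS, Real.norm_of_nonneg (hpos _), Real.norm_of_nonneg (hB _ _)]
  simp only [gP]
  rw [Finset.sum_comm]
  refine Finset.sum_congr rfl fun t _ => ?_
  rw [← Finset.mul_sum, Finset.prod_univ_sum, Fintype.piFinset_univ]
  congr 1
  exact Fintype.sum_equiv (Equiv.curry ι κ (Fin n)) _ _ fun α => rfl

lemma rS_nonneg {n : ℕ} {ι : Type} [Fintype ι] [DecidableEq ι] {𝕜 : Type} [RCLike 𝕜]
    (A : Fin n → (ι → Fin n) → 𝕜) (i : Fin n) : 0 ≤ rS A i :=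
  Finset.sum_nonneg fun _ _ => norm_nonneg _

/-- Every positive vector is the vector of row sums of a nonnegative tensor. -/
lemma exists_nonneg_rS_eq {n : ℕ} {ι : Type} [Fintype ι] [DecidableEq ι]
    {x : Fin n → ℝ} (hx : ∀ i, 0 < x i) :
    ∃ B : Fin n → (ι → Fin n) → ℝ, (∀ i t, 0 ≤ B i t) ∧ ∀ i, rS B i = x i := by
  refine ⟨fun i t => if t = fun _ => i then x i else 0, fun i t => ?_, fun i => ?_⟩
  · dsimp only
    split_ifs
    exacts [(hx i).le, le_rfl]
  · simp [rS, apply_ite, abs_of_pos (hx i)]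

lemma sum_mul_prod_smul {n : ℕ} {ι : Type} [Fintype ι] [DecidableEq ι]
    (a : (ι → Fin n) → ℝ) (x : Fin n → ℝ) (θ : ℝ) :
    ∑ t : ι → Fin n, a t * ∏ j, (θ * x (t j)) =
      θ ^ Fintype.card ι * ∑ t : ι → Fin n, a t * ∏ j, x (t j) := by
  simp only [Finset.prod_mul_distrib, Finset.prod_const, Finset.card_univ, Finset.mul_sum]
  exact Finset.sum_congr rfl fun t _ => by ring

/-- If `x` is a positive eigenvector, some Collatz–Wielandt quotient of a positive vector
is at most the eigenvalue. -/
lemma exists_quotient_le_eigenvalue {n : ℕ} (hn : 1 ≤ n) {ι : Type} [Fintype ι] [DecidableEq ι]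
    {A : Fin n → (ι → Fin n) → ℝ} (hA : ∀ i t, 0 ≤ A i t) {lam : ℝ} {x y : Fin n → ℝ}
    (hx : ∀ i, 0 < x i) (hy : ∀ i, 0 < y i)
    (heig : ∀ i, ∑ t : ι → Fin n, A i t * ∏ j, x (t j) = lam * x i ^ Fintype.card ι) :
    ∃ i, (∑ t : ι → Fin n, A i t * ∏ j, y (t j)) / y i ^ Fintype.card ι ≤ lam := by
  have : Nonempty (Fin n) := ⟨⟨0, hn⟩⟩
  obtain ⟨i, hi⟩ := Finite.exists_max fun i => y i / x i
  refine ⟨i, (div_le_iff₀ (pow_pos (hy i) _)).2 ?_⟩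
  have hyi : y i = y i / x i * x i := (div_mul_cancel₀ _ (hx i).ne').symm
  calc ∑ t : ι → Fin n, A i t * ∏ j, y (t j)
      ≤ ∑ t : ι → Fin n, A i t * ∏ j, (y i / x i * x (t j)) :=
        Finset.sum_le_sum fun t _ => mul_le_mul_of_nonneg_left
          (Finset.prod_le_prod (fun j _ => (hy _).le)
            fun j _ => (div_le_iff₀ (hx _)).1 (hi (t j))) (hA i t)
    _ = lam * y i ^ Fintype.card ι := by
        rw [sum_mul_prod_smul, heig, mul_left_comm, ← mul_pow, ← hyi]

/-- If `x` is a positive eigenvector, some Collatz–Wielandt quotient of a positive vector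
is at least the eigenvalue. -/
lemma exists_eigenvalue_le_quotient {n : ℕ} (hn : 1 ≤ n) {ι : Type} [Fintype ι] [DecidableEq ι]
    {A : Fin n → (ι → Fin n) → ℝ} (hA : ∀ i t, 0 ≤ A i t) {lam : ℝ} {x y : Fin n → ℝ}
    (hx : ∀ i, 0 < x i) (hy : ∀ i, 0 < y i)
    (heig : ∀ i, ∑ t : ι → Fin n, A i t * ∏ j, x (t j) = lam * x i ^ Fintype.card ι) :
    ∃ i, lam ≤ (∑ t : ι → Fin n, A i t * ∏ j, y (t j)) / y i ^ Fintype.card ι := by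
  have : Nonempty (Fin n) := ⟨⟨0, hn⟩⟩
  obtain ⟨i, hi⟩ := Finite.exists_min fun i => y i / x i
  refine ⟨i, (le_div_iff₀ (pow_pos (hy i) _)).2 ?_⟩
  have hyi : y i = y i / x i * x i := (div_mul_cancel₀ _ (hx i).ne').symm
  calc lam * y i ^ Fintype.card ι
      = ∑ t : ι → Fin n, A i t * ∏ j, (y i / x i * x (t j)) := by
        rw [sum_mul_prod_smul, heig, mul_left_comm, ← mul_pow, ← hyi]
    _ ≤ ∑ t : ι → Fin n, A i t * ∏ j, y (t j) :=
        Finset.sum_le_sum fun t _ => mul_le_mul_of_nonneg_left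
          (Finset.prod_le_prod (fun j _ => (mul_pos (div_pos (hy i) (hx i)) (hx _)).le)
            fun j _ => (le_div_iff₀ (hx _)).1 (hi (t j))) (hA i t)

/-- generalized Collatz–Wielandt theorem. For a nonnegative
weakly irreducible tensor `A` with eigenvalue `λ₀` admitting a strictly
positive eigenvector, `λ₀` is both the supremum over nonnegative order-`k`
tensors `B` (with nonzero row sums) of `min_i r_i(AB)/(r_i(B))^(m-1)` and the
infimum over the same family of `max_i r_i(AB)/(r_i(B))^(m-1)`. -/
theorem stmt11 (m n k : ℕ) (hm : 2 ≤ m) (hn : 1 ≤ n) (hk : 1 ≤ k)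
    (A : Fin n → (Fin (m - 1) → Fin n) → ℝ) (hA : ∀ i t, 0 ≤ A i t)
    (hirr : ∀ I : Finset (Fin n), I.Nonempty → I ≠ Finset.univ →
      ∃ i₁ ∈ I, ∃ t : Fin (m - 1) → Fin n, (∀ j, t j ∉ I) ∧ 0 < A i₁ t)
    (lam0 : ℝ) (x : Fin n → ℝ) (hx : ∀ i, 0 < x i)
    (heig : ∀ i : Fin n,
      (∑ t : Fin (m - 1) → Fin n, A i t * ∏ j : Fin (m - 1), x (t j)) = lam0 * x i ^ (m - 1)) :
    (lam0 = ⨆ B : {B : Fin n → (Fin (k - 1) → Fin n) → ℝ //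
        (∀ i t, 0 ≤ B i t) ∧ ∀ i, rS B i ≠ 0},
      minF hn (fun i => rS (gP A B.1) i / (rS B.1 i) ^ (m - 1))) ∧
    (lam0 = ⨅ B : {B : Fin n → (Fin (k - 1) → Fin n) → ℝ //
        (∀ i t, 0 ≤ B i t) ∧ ∀ i, rS B i ≠ 0},
      maxF hn (fun i => rS (gP A B.1) i / (rS B.1 i) ^ (m - 1))) := by
  have hpos (B : {B : Fin n → (Fin (k - 1) → Fin n) → ℝ //
      (∀ i t, 0 ≤ B i t) ∧ ∀ i, rS B i ≠ 0}) (i : Fin n) : 0 < rS B.1 i :=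
    (rS_nonneg _ _).lt_of_ne' (B.2.2 i)
  have heig' (i : Fin n) : ∑ t : Fin (m - 1) → Fin n, A i t * ∏ j, x (t j) =
      lam0 * x i ^ Fintype.card (Fin (m - 1)) := by
    rw [Fintype.card_fin]; exact heig i
  obtain ⟨B₀, hB₀, hr⟩ := exists_nonneg_rS_eq (ι := Fin (k - 1)) hx
  have hquot : (fun i => rS (gP A B₀) i / rS B₀ i ^ (m - 1)) = fun _ => lam0 := by
    funext i
    rw [rS_gP_of_nonneg hA hB₀]
    simp only [hr, heig]
    exact mul_div_cancel_right₀ _ (pow_pos (hx i) _).ne'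
  constructor
  · refine Eq.symm (IsGreatest.csSup_eq ⟨⟨⟨B₀, hB₀, fun i => (hr i).trans_ne (hx i).ne'⟩, ?_⟩, ?_⟩)
    · simp only [hquot, minF]
      exact Finset.inf'_const _ _
    · rintro _ ⟨B, rfl⟩
      obtain ⟨i, hi⟩ := exists_quotient_le_eigenvalue hn hA hx (hpos B) heig'
      rw [← rS_gP_of_nonneg hA B.2.1, Fintype.card_fin] at hi
      exact (Finset.inf'_le _ (Finset.mem_univ i)).trans hi
  · refine Eq.symm (IsLeast.csInf_eq ⟨⟨⟨B₀, hB₀, fun i => (hr i).trans_ne (hx i).ne'⟩, ?_⟩, ?_⟩)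
    · simp only [hquot, maxF]
      exact Finset.sup'_const _ _
    · rintro _ ⟨B, rfl⟩
      obtain ⟨i, hi⟩ := exists_eigenvalue_le_quotient hn hA hx (hpos B) heig'
      rw [← rS_gP_of_nonneg hA B.2.1, Fintype.card_fin] at hi
      exact hi.trans
        (Finset.le_sup' (fun i => rS (gP A B.1) i / rS B.1 i ^ (m - 1)) (Finset.mem_univ i))
end
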